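/- arXiv:math/0203110 — 2 statements merged into one kernel-verified Lean document; each statement's English description precedes it below -/
import Mathlib

section
/- Let W be a real vector space, let d, ι_ε, ι_V be linear endomorphisms of W, let Ω ∈ W, and let m, n be real numbers with m + n ≠ 0. Define L_ε := d∘ι_ε + ι_ε∘d and L_V := d∘ι_V + ι_V∘d. Assume: dΩ = 0; L_ε(Ω) = n•Ω; L_V(Ω) = 0; and (L_V∘ι_ε − ι_ε∘L_V)(Ω) = −m • ι_V(Ω). Then ι_V(Ω) = −(m+n)⁻¹ • d(ι_V(ι_ε(Ω))); in particular ι_V(Ω) lies in the range of d. -/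
/-- Operator-level content of the Lemma: if `Ω` is closed and homogeneous of weight `n`
(`L_ε Ω = n • Ω` with `L_ε = d∘ι_ε + ι_ε∘d`), and `V` is a symmetry of `Ω`
(`L_V Ω = 0`) of weight `m` (`[L_V, ι_ε] Ω = -m • ι_V Ω`) with `m + n ≠ 0`, then
`ι_V Ω` is exact with explicit primitive `-(m+n)⁻¹ • ι_V ι_ε Ω`. -/
theorem stmt_1 {W : Type*} [AddCommGroup W] [Module ℝ W]
    (d ιε ιV : W →ₗ[ℝ] W) (Ω : W) (m n : ℝ) (hmn : m + n ≠ 0)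
    (hclosed : d Ω = 0)
    (hhom : (d ∘ₗ ιε + ιε ∘ₗ d) Ω = n • Ω)
    (hpres : (d ∘ₗ ιV + ιV ∘ₗ d) Ω = 0)
    (hweight : ((d ∘ₗ ιV + ιV ∘ₗ d) ∘ₗ ιε - ιε ∘ₗ (d ∘ₗ ιV + ιV ∘ₗ d)) Ω = -m • ιV Ω) :
    ιV Ω = -(m + n)⁻¹ • d (ιV (ιε Ω)) ∧ ιV Ω ∈ LinearMap.range d := by
  have hdε : d (ιε Ω) = n • Ω := by simpa [hclosed] using hhom
  have hLV : d (ιV (ιε Ω)) + n • ιV Ω = -m • ιV Ω := by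
    simpa only [LinearMap.sub_apply, LinearMap.comp_apply, hpres, map_zero, sub_zero,
      LinearMap.add_apply, hdε, map_smul] using hweight
  have hd : d (ιV (ιε Ω)) = -(m + n) • ιV Ω := by
    rw [eq_sub_of_add_eq hLV]
    module
  have hprim : ιV Ω = -(m + n)⁻¹ • d (ιV (ιε Ω)) := by
    rw [hd, smul_smul, neg_mul_neg, inv_mul_cancel₀ hmn, one_smul]
  exact ⟨hprim, -(m + n)⁻¹ • ιV (ιε Ω), by rw [map_smul, ← hprim]⟩
end

section
/- Let (R, E, ⟨·,·⟩, a, D, ∘) be an algebraic Courant algebroid in which E is a faithful R-module and the form ⟨·,·⟩ is anisotropic (⟨e,e⟩ = 0 implies e = 0). Then the anchor vanishes identically: a(e) = 0 for all e ∈ E, and D = 0. -/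
/-- An algebraic Courant algebroid: a commutative `ℝ`-algebra `R`, an `R`-module `E`
with a nondegenerate symmetric `R`-bilinear pairing, an anchor into the `ℝ`-linear
derivations of `R`, a map `D : R → E` adjoint to the anchor via the pairing, and an
`ℝ`-bilinear operation `∘` satisfying the Courant algebroid axioms (1)-(5). -/
structure AlgebraicCourantAlgebroid (R : Type*) [CommRing R] [Algebra ℝ R]
    (E : Type*) [AddCommGroup E] [Module ℝ E] [Module R E] [IsScalarTower ℝ R E] where
  /-- the pseudo-Euclidean pairing `⟨·,·⟩` -/
  pair : E →ₗ[R] E →ₗ[R] R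
  pair_symm : ∀ e₁ e₂ : E, pair e₁ e₂ = pair e₂ e₁
  pair_nondeg : ∀ e : E, (∀ e' : E, pair e e' = 0) → e = 0
  /-- the anchor `a` -/
  anchor : E →ₗ[R] Derivation ℝ R R
  /-- the map `D = a* ∘ d` -/
  Dmap : R →ₗ[ℝ] E
  pair_Dmap : ∀ (e : E) (f : R), pair e (Dmap f) = anchor e f
  /-- the operation `∘` -/
  circ : E →ₗ[ℝ] E →ₗ[ℝ] E
  /-- axiom (1): left Leibniz identity -/
  circ_leibniz : ∀ e e₁ e₂ : E,
    circ e (circ e₁ e₂) = circ (circ e e₁) e₂ + circ e₁ (circ e e₂)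
  /-- axiom (2): the anchor is bracket-preserving -/
  anchor_circ : ∀ e₁ e₂ : E, anchor (circ e₁ e₂) = ⁅anchor e₁, anchor e₂⁆
  /-- axiom (3): Leibniz rule in the second argument -/
  circ_smul : ∀ (e₁ : E) (f : R) (e₂ : E),
    circ e₁ (f • e₂) = f • circ e₁ e₂ + anchor e₁ f • e₂
  /-- axiom (4): the symmetric part of `∘` is `D⟨·,·⟩` -/
  circ_symmPart : ∀ e₁ e₂ : E, circ e₁ e₂ + circ e₂ e₁ = Dmap (pair e₁ e₂)
  /-- axiom (5): invariance of the pairing -/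
  pair_invariant : ∀ e e₁ e₂ : E,
    anchor e (pair e₁ e₂) = pair (circ e e₁) e₂ + pair e₁ (circ e e₂)

namespace AlgebraicCourantAlgebroid

variable {R : Type*} [CommRing R] [Algebra ℝ R]
  {E : Type*} [AddCommGroup E] [Module ℝ E] [Module R E] [IsScalarTower ℝ R E]
  (C : AlgebraicCourantAlgebroid R E)

theorem Dmap_mul (f g : R) : C.Dmap (f * g) = f • C.Dmap g + g • C.Dmap f := by
  rw [← sub_eq_zero]
  refine C.pair_nondeg _ fun e => ?_
  rw [C.pair_symm, map_sub, map_add, map_smul, map_smul]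
  simp only [C.pair_Dmap, Derivation.leibniz, sub_self]

theorem anchor_Dmap_pair (e₁ e₂ : E) : C.anchor (C.Dmap (C.pair e₁ e₂)) = 0 := by
  rw [← C.circ_symmPart, map_add, C.anchor_circ, C.anchor_circ, ← lie_skew, neg_add_cancel]

theorem pair_smul_anchor_Dmap (f : R) (e₁ e₂ : E) :
    C.pair e₁ e₂ • C.anchor (C.Dmap f) = 0 := by
  have h := C.anchor_Dmap_pair (f • e₁) e₂
  rwa [map_smul, LinearMap.smul_apply, smul_eq_mul, Dmap_mul, map_add, map_smul, map_smul,
    anchor_Dmap_pair, smul_zero, zero_add] at h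

theorem anchor_Dmap_eq_zero (hfaithful : ∀ f : R, (∀ e : E, f • e = 0) → f = 0) (f : R) :
    C.anchor (C.Dmap f) = 0 := by
  ext g
  refine hfaithful _ fun e => C.pair_nondeg _ fun e' => ?_
  rw [map_smul, LinearMap.smul_apply, smul_eq_mul, mul_comm]
  exact DFunLike.congr_fun (C.pair_smul_anchor_Dmap f e e') g

end AlgebraicCourantAlgebroid

/-- In an algebraic Courant algebroid with `E` faithful and the pairing anisotropic,
the anchor and `D` vanish identically. -/
theorem stmt_8 {R : Type*} [CommRing R] [Algebra ℝ R]
    {E : Type*} [AddCommGroup E] [Module ℝ E] [Module R E] [IsScalarTower ℝ R E]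
    (C : AlgebraicCourantAlgebroid R E)
    (hfaithful : ∀ f : R, (∀ e : E, f • e = 0) → f = 0)
    (haniso : ∀ e : E, C.pair e e = 0 → e = 0) :
    (∀ e : E, C.anchor e = 0) ∧ (∀ f : R, C.Dmap f = 0) := by
  have hD (f : R) : C.Dmap f = 0 := haniso _ <| by
    rw [C.pair_Dmap, C.anchor_Dmap_eq_zero hfaithful, Derivation.zero_apply]
  refine ⟨fun e => ?_, hD⟩
  ext f
  rw [← C.pair_Dmap, hD, map_zero, Derivation.zero_apply]
end
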